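/- Let 0 < λ < 1 and let a red/blue two-coloring of the edges of the complete graph K_n be given together with a vertex partition A ∪ B such that |A| ≥ (1/2 − λ)n, |B| ≥ (1/2 − λ)n, the red density within A is at least 1 − λ, the red density within B is at least 1 − λ, and the blue density between A and B is at least 1 − λ. Then there is a vertex partition of K_n as A' ∪ B' ∪ X ∪ Y satisfying: (1) A = A' ∪ X and B = B' ∪ Y; (2) |X| ≤ 2√λ|A| and |Y| ≤ 2√λ|B|; (3) |A'| ≥ (1/2 − 2√λ)n and |B'| ≥ (1/2 − 2√λ)n; (4) each vertex in A' has red degree at least (1 − 3√λ)|A| in A' and blue degree at least (1 − 3√λ)|B| in B', and each vertex in B' has red degree at least (1 − 3√λ)|B| in B' and blue degree at least (1 − 3√λ)|A| in A'. -/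

import Mathlib

open Finset
open scoped Classical

noncomputable section

/-- Number of ordered pairs `(x, y) ∈ X × Y` that are adjacent in `G`. -/
def interPairs {V : Type*} (G : SimpleGraph V) (X Y : Finset V) : ℕ :=
  ((X ×ˢ Y).filter fun p => G.Adj p.1 p.2).card

/-- The edge density `d(X, Y) = e(X, Y) / (|X| |Y|)` between disjoint sets `X` and `Y`. -/
def dens {V : Type*} (G : SimpleGraph V) (X Y : Finset V) : ℝ :=
  (interPairs G X Y : ℝ) / ((X.card : ℝ) * (Y.card : ℝ))

/-- The density `2 e(X) / |X| ^ 2` of a vertex set `X` in `G`. -/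
def densIn {V : Type*} (G : SimpleGraph V) (X : Finset V) : ℝ :=
  (interPairs G X X : ℝ) / ((X.card : ℝ) ^ 2)

lemma interPairs_comm {V : Type*} (G : SimpleGraph V) (X Y : Finset V) :
    interPairs G X Y = interPairs G Y X := by
  unfold interPairs
  refine Finset.card_bij' (fun p _ => p.swap) (fun p _ => p.swap) ?_ ?_ ?_ ?_ <;>
    simp +contextual [G.adj_comm]

lemma interPairs_eq_sum {V : Type*} (G : SimpleGraph V) (X Y : Finset V) :
    interPairs G X Y = ∑ v ∈ X, (Y.filter fun u => G.Adj v u).card := by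
  simp only [interPairs, Finset.card_filter, Finset.sum_product]

/-- If `G` has density at least `1 - s ^ 2` between `X` and `Y`, then at most `s |X|` vertices
of `X` have fewer than `(1 - s) |Y|` neighbors in `Y`. -/
lemma card_filter_degree_lt_le {V : Type*} (G : SimpleGraph V) (X Y : Finset V) {s : ℝ}
    (hs : 0 < s) (hY : 0 < (Y.card : ℝ))
    (h : (1 - s ^ 2) * (X.card * Y.card) ≤ (interPairs G X Y : ℝ)) :
    ((X.filter fun v => ((Y.filter fun u => G.Adj v u).card : ℝ) < (1 - s) * Y.card).card : ℝ)
      ≤ s * X.card := by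
  have hsum : (interPairs G X Y : ℝ) ≤ ∑ v ∈ X, ((Y.card : ℝ) - if
      ((Y.filter fun u => G.Adj v u).card : ℝ) < (1 - s) * Y.card then s * Y.card else 0) := by
    rw [interPairs_eq_sum, Nat.cast_sum]
    refine Finset.sum_le_sum fun v _ => ?_
    split_ifs with hv
    · linarith
    · rw [sub_zero]
      exact_mod_cast Finset.card_filter_le _ _
  rw [Finset.sum_sub_distrib, ← Finset.sum_filter, Finset.sum_const, Finset.sum_const,
    nsmul_eq_mul, nsmul_eq_mul] at hsum
  refine le_of_mul_le_mul_right ?_ (mul_pos hs hY)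
  linarith

/-- Deleting a set `Z` of at most `2 s |Y|` vertices from `Y` lowers a degree of at least
`(1 - s) |Y|` to no less than `(1 - 3 s) |Y|`. -/
lemma le_card_filter_sdiff {V : Type*} [DecidableEq V] (G : SimpleGraph V) (Y Z : Finset V)
    (v : V) {s : ℝ}
    (hZ : (Z.card : ℝ) ≤ 2 * s * Y.card)
    (h : (1 - s) * Y.card ≤ ((Y.filter fun u => G.Adj v u).card : ℝ)) :
    (1 - 3 * s) * Y.card ≤ (((Y \ Z).filter fun u => G.Adj v u).card : ℝ) := by
  have hsub : (Y.filter fun u => G.Adj v u) ⊆ ((Y \ Z).filter fun u => G.Adj v u) ∪ Z := by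
    intro u
    simp only [Finset.mem_filter, Finset.mem_union, Finset.mem_sdiff]
    tauto
  have hcard : ((Y.filter fun u => G.Adj v u).card : ℝ) ≤
      (((Y \ Z).filter fun u => G.Adj v u).card : ℝ) + Z.card := by
    exact_mod_cast (Finset.card_le_card hsub).trans (Finset.card_union_le _ _)
  linarith

lemma half_sub_mul_le_card_sdiff {V : Type*} [DecidableEq V] (X Z : Finset V) {n s : ℝ}
    (hn : 0 ≤ n) (hs : 0 < s) (hZ : (Z.card : ℝ) ≤ 2 * s * X.card)
    (hX : (1 / 2 - s ^ 2) * n ≤ (X.card : ℝ)) :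
    (1 / 2 - 2 * s) * n ≤ ((X \ Z).card : ℝ) := by
  rcases le_total (1 / 2) (2 * s) with h | h
  · exact (mul_nonpos_of_nonpos_of_nonneg (by linarith) hn).trans (Nat.cast_nonneg _)
  · have hcard : (X.card : ℝ) ≤ (X \ Z).card + Z.card := by
      exact_mod_cast Finset.card_le_card_sdiff_add_card
    have hmul := mul_le_mul_of_nonneg_left hX (show 0 ≤ 1 - 2 * s by linarith)
    have hpos : 0 ≤ (s * (1 - s) + 2 * s ^ 3) * n :=
      mul_nonneg (add_nonneg (mul_nonneg hs.le (by linarith)) (by positivity)) hn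
    nlinarith

lemma exists_small_degree_lt_set {V : Type*} [DecidableEq V] (G H : SimpleGraph V)
    (X Y : Finset V) {s : ℝ} (hs : 0 < s) (hX : 0 < (X.card : ℝ)) (hY : 0 < (Y.card : ℝ))
    (hG : (1 - s ^ 2) * (X.card * X.card) ≤ (interPairs G X X : ℝ))
    (hH : (1 - s ^ 2) * (X.card * Y.card) ≤ (interPairs H X Y : ℝ)) :
    ∃ Z ⊆ X, (Z.card : ℝ) ≤ 2 * s * X.card ∧ ∀ v ∈ X \ Z,
      (1 - s) * X.card ≤ ((X.filter fun u => G.Adj v u).card : ℝ) ∧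
      (1 - s) * Y.card ≤ ((Y.filter fun u => H.Adj v u).card : ℝ) := by
  refine ⟨(X.filter fun v => ((X.filter fun u => G.Adj v u).card : ℝ) < (1 - s) * X.card) ∪
    (X.filter fun v => ((Y.filter fun u => H.Adj v u).card : ℝ) < (1 - s) * Y.card),
    Finset.union_subset (Finset.filter_subset _ _) (Finset.filter_subset _ _), ?_, ?_⟩
  · have h₁ := card_filter_degree_lt_le G X X hs hX hG
    have h₂ := card_filter_degree_lt_le H X Y hs hY hH
    refine (Nat.cast_le.2 (Finset.card_union_le _ _)).trans ?_
    push_cast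
    linarith
  · intro v hv
    simp only [Finset.mem_sdiff, Finset.mem_union, Finset.mem_filter, not_or, not_and,
      not_lt] at hv
    exact ⟨hv.2.1 hv.1, hv.2.2 hv.1⟩

lemma card_pos_of_densIn_pos {V : Type*} (G : SimpleGraph V) (X : Finset V)
    (h : 0 < densIn G X) : 0 < (X.card : ℝ) := by
  refine (Nat.cast_nonneg _).lt_of_ne fun h0 => ?_
  simp [densIn, ← h0] at h

/-- A red/blue coloring of `K_n` is given by its red graph `R`; the blue graph is `Rᶜ`. -/
theorem stmt_9 (n : ℕ) (lam : ℝ) (hlam0 : 0 < lam) (hlam1 : lam < 1)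
    (R : SimpleGraph (Fin n))
    (A B : Finset (Fin n)) (hAB : Disjoint A B) (hunion : A ∪ B = Finset.univ)
    (hAcard : (1 / 2 - lam) * n ≤ (A.card : ℝ))
    (hBcard : (1 / 2 - lam) * n ≤ (B.card : ℝ))
    (hAred : 1 - lam ≤ densIn R A) (hBred : 1 - lam ≤ densIn R B)
    (hABblue : 1 - lam ≤ dens Rᶜ A B) :
    ∃ A' X B' Y : Finset (Fin n),
      A = A' ∪ X ∧ Disjoint A' X ∧ B = B' ∪ Y ∧ Disjoint B' Y ∧
      (X.card : ℝ) ≤ 2 * Real.sqrt lam * A.card ∧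
      (Y.card : ℝ) ≤ 2 * Real.sqrt lam * B.card ∧
      (1 / 2 - 2 * Real.sqrt lam) * n ≤ (A'.card : ℝ) ∧
      (1 / 2 - 2 * Real.sqrt lam) * n ≤ (B'.card : ℝ) ∧
      (∀ v ∈ A',
        (1 - 3 * Real.sqrt lam) * A.card ≤ ((A'.filter fun u => R.Adj v u).card : ℝ) ∧
        (1 - 3 * Real.sqrt lam) * B.card ≤ ((B'.filter fun u => Rᶜ.Adj v u).card : ℝ)) ∧
      (∀ v ∈ B',
        (1 - 3 * Real.sqrt lam) * B.card ≤ ((B'.filter fun u => R.Adj v u).card : ℝ) ∧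
        (1 - 3 * Real.sqrt lam) * A.card ≤ ((A'.filter fun u => Rᶜ.Adj v u).card : ℝ)) := by
  have hs : 0 < Real.sqrt lam := Real.sqrt_pos.2 hlam0
  have hsq : lam = Real.sqrt lam ^ 2 := (Real.sq_sqrt hlam0.le).symm
  set s := Real.sqrt lam
  have hA : 0 < (A.card : ℝ) := card_pos_of_densIn_pos R A (by linarith)
  have hB : 0 < (B.card : ℝ) := card_pos_of_densIn_pos R B (by linarith)
  rw [densIn, le_div_iff₀ (pow_pos hA 2), hsq, sq (A.card : ℝ)] at hAred
  rw [densIn, le_div_iff₀ (pow_pos hB 2), hsq, sq (B.card : ℝ)] at hBred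
  rw [_root_.dens, le_div_iff₀ (mul_pos hA hB), hsq] at hABblue
  have hBAblue : (1 - s ^ 2) * (B.card * A.card) ≤ (interPairs Rᶜ B A : ℝ) := by
    rwa [interPairs_comm, mul_comm (B.card : ℝ)]
  rw [hsq] at hAcard hBcard
  obtain ⟨X, hXA, hX, hXdeg⟩ := exists_small_degree_lt_set R Rᶜ A B hs hA hB hAred hABblue
  obtain ⟨Y, hYB, hY, hYdeg⟩ := exists_small_degree_lt_set R Rᶜ B A hs hB hA hBred hBAblue
  exact ⟨A \ X, X, B \ Y, Y, (Finset.sdiff_union_of_subset hXA).symm, Finset.sdiff_disjoint,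
    (Finset.sdiff_union_of_subset hYB).symm, Finset.sdiff_disjoint, hX, hY,
    half_sub_mul_le_card_sdiff A X (Nat.cast_nonneg n) hs hX hAcard,
    half_sub_mul_le_card_sdiff B Y (Nat.cast_nonneg n) hs hY hBcard,
    fun v hv => ⟨le_card_filter_sdiff R A X v hX (hXdeg v hv).1,
      by convert le_card_filter_sdiff Rᶜ B Y v hY (hXdeg v hv).2⟩,
    fun v hv => ⟨le_card_filter_sdiff R B Y v hY (hYdeg v hv).1,
      by convert le_card_filter_sdiff Rᶜ A X v hX (hYdeg v hv).2⟩⟩
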